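/- arXiv:1808.02218 — 2 statements merged into one kernel-verified Lean document; each statement's English description precedes it below -/
import Mathlib

section
/- (Generalised Blaschke–Santaló inequality, symmetric case) Let n ≥ 1 and α, β > 0 satisfy n/α + 1/β ≥ 1 and 1/α + n/β ≥ 1. Then there is a constant C = C(n,α,β) such that for every origin-symmetric convex body Ω in ℝ^{n+1}, (∫_{S^n} r_Ω^α dσ)^{1/α} · (∫_{S^n} r_{Ω^*}^β dσ)^{1/β} ≤ C, where Ω* is the polar body with respect to the origin. -/
open MeasureTheory Metric

/-- The radial function of `Ω` with respect to the origin: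
`r_Ω(x) = sup {λ > 0 : λx ∈ Ω}`. -/
noncomputable def radial {n : ℕ} (Ω : Set (EuclideanSpace ℝ (Fin (n+1))))
    (x : EuclideanSpace ℝ (Fin (n+1))) : ℝ :=
  sSup {l : ℝ | 0 < l ∧ l • x ∈ Ω}

/-- The polar body of `Ω` with respect to the origin. -/
def polarBody {n : ℕ} (Ω : Set (EuclideanSpace ℝ (Fin (n+1)))) :
    Set (EuclideanSpace ℝ (Fin (n+1))) :=
  {y | ∀ x ∈ Ω, ∑ i, x i * y i ≤ 1}

/-- The standard surface measure `σ` on the unit sphere `S^n ⊆ ℝ^(n+1)`. -/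
noncomputable def sphereMeasure (n : ℕ) :
    Measure (sphere (0 : EuclideanSpace ℝ (Fin (n+1))) 1) :=
  (volume : Measure (EuclideanSpace ℝ (Fin (n+1)))).toSphere

open scoped ENNReal

theorem lintegral_fin_prod_eq_prod {d : ℕ} (f : Fin d → ℝ → ℝ≥0∞) (hf : ∀ i, Measurable (f i)) :
    ∫⁻ x : Fin d → ℝ, ∏ i, f i (x i) = ∏ i, ∫⁻ t, f i t := by
  induction d with
  | zero => simp [volume_pi]
  | succ d ih =>
    have hmp := (volume_preserving_piFinSuccAbove (fun _ : Fin (d + 1) => ℝ) 0).symm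
    rw [← hmp.lintegral_comp_emb (MeasurableEquiv.measurableEmbedding _)]
    simp only [MeasurableEquiv.piFinSuccAbove_symm_apply, Fin.prod_univ_succ]
    simp only [Fin.insertNthEquiv, Equiv.coe_fn_mk, Fin.insertNth_zero', Fin.cons_zero,
      Fin.cons_succ]
    rw [← ih (fun i => f i.succ) (fun i => hf _)]
    exact lintegral_prod_mul (μ := volume) (ν := volume) (f := f 0) (g := fun y : Fin d → ℝ => ∏ i, f i.succ (y i))
      (hf 0).aemeasurable
      (Finset.measurable_fun_prod _ fun i _ =>
        (hf i.succ).comp (measurable_pi_apply i)).aemeasurable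

/-- Scaling of a Lebesgue integral over the line. -/
theorem lintegral_comp_mul_left_eq (g : ℝ → ℝ≥0∞) (hg : Measurable g) {s : ℝ} (hs : 0 < s) :
    ∫⁻ t, g (s * t) = ENNReal.ofReal s⁻¹ * ∫⁻ t, g t := by
  rw [← lintegral_map hg (measurable_const_mul s), Real.map_volume_mul_left hs.ne',
    lintegral_smul_measure, abs_of_pos (inv_pos.2 hs), smul_eq_mul]

theorem lintegral_min_one_inv_rpow_lt_top {γ : ℝ} (hγ : 1 < γ) :
    ∫⁻ t : ℝ, (min 1 (‖t‖ₑ⁻¹)) ^ γ < ∞ := by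
  have hγ0 : 0 < γ := by linarith
  have h := finite_integral_one_add_norm (E := ℝ) (μ := volume) (r := γ) (by simpa using hγ)
  refine lt_of_le_of_lt (b := ENNReal.ofReal (2 ^ γ) *
    ∫⁻ x : ℝ, ENNReal.ofReal ((1 + ‖x‖) ^ (-γ))) ?_ (ENNReal.mul_lt_top (by simp) h)
  rw [← lintegral_const_mul _ (by fun_prop)]
  refine lintegral_mono fun t => ?_
  rw [← ENNReal.ofReal_mul (by positivity), Real.rpow_neg (by positivity),
    ← Real.inv_rpow (by positivity), ← Real.mul_rpow (by positivity) (by positivity),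
    ← ENNReal.ofReal_rpow_of_nonneg (by positivity) hγ0.le]
  refine ENNReal.rpow_le_rpow ?_ hγ0.le
  rcases le_total ‖t‖ 1 with ht | ht
  · refine (min_le_left _ _).trans ?_
    rw [← ENNReal.ofReal_one]
    refine ENNReal.ofReal_le_ofReal ?_
    rw [← div_eq_mul_inv, le_div_iff₀ (by positivity)]
    linarith
  · refine (min_le_right _ _).trans ?_
    rw [← ofReal_norm, ← ENNReal.ofReal_inv_of_pos (by linarith)]
    refine ENNReal.ofReal_le_ofReal ?_
    rw [← div_eq_mul_inv, le_div_iff₀ (by positivity), inv_mul_le_iff₀ (by linarith)]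
    linarith

theorem lintegral_Icc_inv_enorm_rpow_lt_top {γ : ℝ} (hγ0 : 0 ≤ γ) (hγ : γ < 1) :
    ∫⁻ t in Set.Icc (-1 : ℝ) 1, (‖t‖ₑ⁻¹) ^ γ < ∞ := by
  have hi : IntervalIntegrable (fun x : ℝ => |x| ^ (-γ)) volume (-1) 1 := by
    have h1 : IntervalIntegrable (fun x : ℝ => x ^ (-γ)) volume 0 1 :=
      intervalIntegral.intervalIntegrable_rpow' (by linarith)
    have h2 : IntervalIntegrable (fun x : ℝ => |x| ^ (-γ)) volume 0 1 := by
      refine h1.congr ?_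
      intro x hx
      rw [Set.uIoc_of_le zero_le_one] at hx
      simp only [abs_of_pos hx.1]
    have h3 : IntervalIntegrable (fun x : ℝ => |x| ^ (-γ)) volume (-1) 0 := by
      have := (IntervalIntegrable.iff_comp_neg (by simp)).1 h2
      simpa using this.symm
    exact h3.trans h2
  rw [intervalIntegrable_iff_integrableOn_Icc_of_le (by norm_num)] at hi
  have h := hi.hasFiniteIntegral
  unfold HasFiniteIntegral at h
  refine lt_of_le_of_lt (le_of_eq ?_) h
  refine lintegral_congr_ae (ae_restrict_of_ae ?_)
  have h0 : ∀ᵐ t : ℝ, t ≠ 0 := by simp [ae_iff]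
  filter_upwards [h0] with t ht
  have ht' : 0 < |t| := abs_pos.2 ht
  have h1 : ‖|t| ^ (-γ)‖ₑ = ENNReal.ofReal (|t| ^ (-γ)) := Real.enorm_of_nonneg (by positivity)
  rw [h1, Real.rpow_neg ht'.le, ← Real.inv_rpow ht'.le,
    ← ENNReal.ofReal_rpow_of_nonneg (by positivity) hγ0, ENNReal.ofReal_inv_of_pos ht',
    Real.enorm_eq_ofReal_abs]

theorem exists_lintegral_min_div_rpow_le {γ : ℝ} (hγ0 : 0 ≤ γ) (hγ : γ ≠ 1) :
    ∃ C : ℝ≥0∞, C ≠ ∞ ∧ ∀ B a : ℝ≥0∞, B ≠ 0 → B ≠ ∞ → a ≠ 0 → a ≠ ∞ →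
      ∫⁻ t in Set.Icc (-1 : ℝ) 1, (min B (a / ‖t‖ₑ)) ^ γ
        ≤ C * (a ^ (min γ 1) * B ^ (γ - min γ 1)) := by
  rcases lt_or_gt_of_ne hγ with h | h
  · refine ⟨_, (lintegral_Icc_inv_enorm_rpow_lt_top hγ0 h).ne, fun B a _ _ _ _ => ?_⟩
    rw [min_eq_left h.le, sub_self, ENNReal.rpow_zero, mul_one, mul_comm,
      ← lintegral_const_mul _ (by fun_prop)]
    refine lintegral_mono fun t => ?_
    rw [← ENNReal.mul_rpow_of_nonneg _ _ hγ0, ← div_eq_mul_inv]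
    exact ENNReal.rpow_le_rpow (min_le_right _ _) hγ0
  · refine ⟨_, (lintegral_min_one_inv_rpow_lt_top h).ne, fun B a hB hB' ha ha' => ?_⟩
    rw [min_eq_right h.le, ENNReal.rpow_one]
    refine (setLIntegral_le_lintegral _ _).trans ?_
    set s : ℝ := (B / a).toReal with hs
    have hBa : B / a ≠ 0 := by simp [hB, ha']
    have hBa' : B / a ≠ ∞ := ENNReal.div_ne_top hB' ha
    have hspos : 0 < s := ENNReal.toReal_pos hBa hBa'
    have hsE : ENNReal.ofReal s = B / a := ENNReal.ofReal_toReal hBa'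
    have key : ∀ t : ℝ, (min B (a / ‖t‖ₑ)) ^ γ = B ^ γ * (min 1 (‖s * t‖ₑ⁻¹)) ^ γ := by
      intro t
      rw [← ENNReal.mul_rpow_of_nonneg _ _ hγ0]
      congr 1
      have : B * min 1 (‖s * t‖ₑ⁻¹) = min (B * 1) (B * ‖s * t‖ₑ⁻¹) :=
        (mul_right_mono (a := B)).map_min
      rw [this, mul_one]
      congr 1
      rw [enorm_mul, Real.enorm_of_nonneg hspos.le, hsE,
        ENNReal.mul_inv (Or.inl hBa) (Or.inl hBa'), ENNReal.inv_div (Or.inl ha') (Or.inl ha),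
        div_eq_mul_inv, div_eq_mul_inv,
        show B * (a * B⁻¹ * ‖t‖ₑ⁻¹) = B * B⁻¹ * (a * ‖t‖ₑ⁻¹) by ring,
        ENNReal.mul_inv_cancel hB hB', one_mul]
    simp_rw [key]
    rw [lintegral_const_mul _ (by fun_prop),
      lintegral_comp_mul_left_eq (fun u : ℝ => (min 1 (‖u‖ₑ⁻¹)) ^ γ) (by fun_prop) hspos,
      ENNReal.ofReal_inv_of_pos hspos, hsE, ENNReal.inv_div (Or.inl ha') (Or.inl ha),
      ENNReal.rpow_sub _ _ hB hB', ENNReal.rpow_one]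
    apply le_of_eq
    simp only [div_eq_mul_inv]
    ring

theorem ENNReal.rpow_sum_of_nonneg {ι : Type*} {s : Finset ι} {e : ι → ℝ} (x : ℝ≥0∞)
    (he : ∀ i ∈ s, 0 ≤ e i) : x ^ (∑ i ∈ s, e i) = ∏ i ∈ s, x ^ e i := by
  classical
  induction s using Finset.induction_on with
  | empty => simp
  | insert i s hi ih =>
    rw [Finset.sum_insert hi, Finset.prod_insert hi,
      ENNReal.rpow_add_of_nonneg _ _ (he i (by simp))
        (Finset.sum_nonneg fun j hj => he j (by simp [hj])),
      ih fun j hj => he j (by simp [hj])]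

theorem lintegral_sphereMeasure_le {n : ℕ} {G H : EuclideanSpace ℝ (Fin (n + 1)) → ℝ≥0∞}
    (hG : Measurable G) (h : ∀ x, x ≠ 0 → ‖x‖ < 1 → G (‖x‖⁻¹ • x) ≤ H x) :
    ∫⁻ x : sphere (0 : EuclideanSpace ℝ (Fin (n + 1))) 1, G x ∂(sphereMeasure n)
      ≤ (n + 1) * ∫⁻ x, H x := by
  let E := EuclideanSpace ℝ (Fin (n + 1))
  let ν := Measure.volumeIoiPow (Module.finrank ℝ E - 1)
  have hmp := (volume : Measure E).measurePreserving_homeomorphUnitSphereProd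
  let one : Set.Ioi (0 : ℝ) := ⟨1, Set.mem_Ioi.2 one_pos⟩
  have hν : ν (Set.Iio one) = ((n : ℝ≥0∞) + 1)⁻¹ := by
    have hn : (0 : ℝ) < n + 1 := by positivity
    simp only [ν, Measure.volumeIoiPow_apply_Iio, E, finrank_euclideanSpace, Fintype.card_fin,
      Nat.add_sub_cancel, one, one_pow, one_div]
    rw [ENNReal.ofReal_inv_of_pos hn, ENNReal.ofReal_add (by positivity) zero_le_one]
    simp
  have h1 : ∫⁻ p, G (p.1 : E) * (Set.Iio one).indicator 1 p.2 ∂((sphereMeasure n).prod ν)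
      = (∫⁻ x, G (x : E) ∂(sphereMeasure n)) * ((n : ℝ≥0∞) + 1)⁻¹ := by
    have := lintegral_prod_mul (μ := sphereMeasure n) (ν := ν)
      (f := fun x => G (x : E)) (g := (Set.Iio one).indicator 1)
      (hG.comp measurable_subtype_coe).aemeasurable
      (measurable_one.indicator measurableSet_Iio).aemeasurable
    rw [← hν, ← lintegral_indicator_one measurableSet_Iio, ← this]
  have h2 : ∫⁻ p, G (p.1 : E) * (Set.Iio one).indicator 1 p.2 ∂((sphereMeasure n).prod ν)
      ≤ ∫⁻ x, H x := by
    rw [sphereMeasure, ← hmp.lintegral_comp_emb (Homeomorph.measurableEmbedding _)]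
    refine le_trans (lintegral_mono (g := fun y : ({0}ᶜ : Set E) => H y) fun y => ?_) ?_
    · by_cases hy : ‖(y : E)‖ < 1
      · rw [Set.indicator_of_mem (by simpa [one, ← Subtype.coe_lt_coe] using hy)]
        simpa using h y y.2 hy
      · rw [Set.indicator_of_notMem (by simpa [one, ← Subtype.coe_lt_coe] using hy)]
        simp
    · rw [lintegral_subtype_comap (measurableSet_singleton _).compl]
      exact setLIntegral_le_lintegral _ _
  rw [h1] at h2
  have hn0 : (n : ℝ≥0∞) + 1 ≠ 0 := by simp
  have hn1 : (n : ℝ≥0∞) + 1 ≠ ∞ := by simp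
  calc _ = (n + 1) * ((∫⁻ x, G (x : E) ∂(sphereMeasure n)) * ((n : ℝ≥0∞) + 1)⁻¹) := by
        rw [mul_comm, mul_assoc, ENNReal.inv_mul_cancel hn0 hn1, mul_one]
    _ ≤ _ := by gcongr

/-- The radial function of the orthotope `{x | ∀ i, |⟪b i, x⟫| ≤ c i}`. -/
noncomputable def boxRadial {n : ℕ}
    (b : OrthonormalBasis (Fin (n + 1)) ℝ (EuclideanSpace ℝ (Fin (n + 1))))
    (c : Fin (n + 1) → ℝ≥0∞) (x : EuclideanSpace ℝ (Fin (n + 1))) : ℝ≥0∞ :=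
  ⨅ i, c i / ‖inner ℝ (b i) x‖ₑ

theorem measurable_boxRadial {n : ℕ}
    (b : OrthonormalBasis (Fin (n + 1)) ℝ (EuclideanSpace ℝ (Fin (n + 1))))
    (c : Fin (n + 1) → ℝ≥0∞) : Measurable (boxRadial b c) := by
  unfold boxRadial
  refine Measurable.iInf fun i => ?_
  have : Measurable fun x => inner ℝ (b i) x := by fun_prop
  fun_prop

theorem lintegral_prod_inner {n : ℕ}
    (b : OrthonormalBasis (Fin (n + 1)) ℝ (EuclideanSpace ℝ (Fin (n + 1))))
    (g : Fin (n + 1) → ℝ → ℝ≥0∞) (hg : ∀ i, Measurable (g i)) :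
    ∫⁻ x, ∏ i, g i (inner ℝ (b i) x) = ∏ i, ∫⁻ t, g i t := by
  have hm : Measurable fun y : Fin (n + 1) → ℝ => ∏ i, g i (y i) :=
    Finset.measurable_fun_prod _ fun i _ => (hg i).comp (measurable_pi_apply i)
  rw [← lintegral_fin_prod_eq_prod g hg,
    ← ((PiLp.volume_preserving_ofLp (Fin (n + 1))).comp
      b.measurePreserving_repr).lintegral_comp hm]
  simp [OrthonormalBasis.repr_apply_apply]

theorem boxRadial_normalize_le {n : ℕ}
    (b : OrthonormalBasis (Fin (n + 1)) ℝ (EuclideanSpace ℝ (Fin (n + 1))))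
    (c : Fin (n + 1) → ℝ≥0∞) {x : EuclideanSpace ℝ (Fin (n + 1))} (hx : x ≠ 0) (hx1 : ‖x‖ < 1)
    (i : Fin (n + 1)) :
    boxRadial b c (‖x‖⁻¹ • x) ≤ c i / ‖inner ℝ (b i) x‖ₑ := by
  refine (iInf_le _ i).trans (ENNReal.div_le_div_left ?_ _)
  have hx0 : 0 < ‖x‖ := norm_pos_iff.2 hx
  rw [inner_smul_right, enorm_mul]
  refine le_mul_of_one_le_left' ?_
  rw [Real.enorm_of_nonneg (by positivity), ← ENNReal.ofReal_one]
  exact ENNReal.ofReal_le_ofReal ((one_le_inv₀ hx0).2 hx1.le)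

theorem exists_boxRadial_normalize_le {n : ℕ}
    (b : OrthonormalBasis (Fin (n + 1)) ℝ (EuclideanSpace ℝ (Fin (n + 1))))
    {x : EuclideanSpace ℝ (Fin (n + 1))} (hx : x ≠ 0) :
    ∃ k, ∀ c : Fin (n + 1) → ℝ≥0∞, boxRadial b c (‖x‖⁻¹ • x) ≤ (n + 1) * c k := by
  obtain ⟨k, hk⟩ := Finite.exists_max fun i => |inner ℝ (b i) x|
  refine ⟨k, fun c => (iInf_le _ k).trans ?_⟩
  have hx0 : 0 < ‖x‖ := norm_pos_iff.2 hx
  have hle : ‖x‖ ≤ (n + 1) * |inner ℝ (b k) x| := by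
    calc ‖x‖ = ‖∑ i, inner ℝ (b i) x • b i‖ := by rw [b.sum_repr']
      _ ≤ ∑ i, |inner ℝ (b i) x| := by
        refine (norm_sum_le _ _).trans (le_of_eq ?_)
        simp [norm_smul]
      _ ≤ ∑ _i : Fin (n + 1), |inner ℝ (b k) x| := Finset.sum_le_sum fun i _ => hk i
      _ = _ := by simp
  have hpos : 0 < |inner ℝ (b k) x| := by
    by_contra hcon
    nlinarith [abs_nonneg (inner ℝ (b k) x), hcon]
  rw [ENNReal.div_eq_inv_mul]
  gcongr
  rw [inner_smul_right, Real.enorm_eq_ofReal_abs, abs_mul, abs_of_pos (inv_pos.2 hx0),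
    ← ENNReal.ofReal_inv_of_pos (by positivity)]
  calc _ ≤ ENNReal.ofReal ((n : ℝ) + 1) := by
        refine ENNReal.ofReal_le_ofReal ?_
        rw [mul_inv, inv_inv, ← div_eq_mul_inv, div_le_iff₀ hpos]
        exact hle
    _ = _ := by
      rw [ENNReal.ofReal_add (by positivity) zero_le_one]
      simp

/-- An upper bound for the `α`-th moment of the radial function of an orthotope. On the part of
the sphere where the `k`-th coordinate is the largest one, the integrand is split with the
exponents `γ k`. -/
theorem exists_lintegral_boxRadial_le {n : ℕ} {α : ℝ}
    (γ : Fin (n + 1) → Fin (n + 1) → ℝ) (hγ0 : ∀ k i, 0 ≤ γ k i)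
    (hγ1 : ∀ k i, i ≠ k → γ k i ≠ 1) (hsum : ∀ k, ∑ i, γ k i = α) :
    ∃ K : ℝ≥0∞, K ≠ ∞ ∧
      ∀ (b : OrthonormalBasis (Fin (n + 1)) ℝ (EuclideanSpace ℝ (Fin (n + 1))))
        (c : Fin (n + 1) → ℝ≥0∞), (∀ i, c i ≠ 0) → (∀ i, c i ≠ ∞) →
      ∀ M : ℝ≥0∞, (∀ k, c k ^ γ k k * ∏ i ∈ Finset.univ.erase k,
          (c i ^ min (γ k i) 1 * c k ^ (γ k i - min (γ k i) 1)) ≤ M) →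
        ∫⁻ x : sphere (0 : EuclideanSpace ℝ (Fin (n + 1))) 1, boxRadial b c x ^ α
          ∂(sphereMeasure n) ≤ K * M := by
  have hC : ∀ k i, ∃ C : ℝ≥0∞, C ≠ ∞ ∧ (i ≠ k → ∀ B a : ℝ≥0∞, B ≠ 0 → B ≠ ∞ → a ≠ 0 → a ≠ ∞ →
      ∫⁻ t in Set.Icc (-1 : ℝ) 1, (min B (a / ‖t‖ₑ)) ^ γ k i
        ≤ C * (a ^ (min (γ k i) 1) * B ^ (γ k i - min (γ k i) 1))) := by
    intro k i
    by_cases hik : i = k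
    · exact ⟨0, by simp, fun h => absurd hik h⟩
    · obtain ⟨C, hC, h⟩ := exists_lintegral_min_div_rpow_le (hγ0 k i) (hγ1 k i hik)
      exact ⟨C, hC, fun _ => h⟩
  choose C hCtop hC using hC
  set D : ℝ≥0∞ := n + 1 with hD
  have hD0 : D ≠ 0 := by simp [hD]
  have hD1 : D ≠ ∞ := by simp [hD]
  have hdiff : ∀ k i, 0 ≤ γ k i - min (γ k i) 1 := fun k i => sub_nonneg.2 (min_le_left _ _)
  let K : Fin (n + 1) → ℝ≥0∞ := fun k => D ^ γ k k *
    (2 * ∏ i ∈ Finset.univ.erase k, (C k i * D ^ (γ k i - min (γ k i) 1)))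
  have hK : ∀ k, K k ≠ ∞ := fun k =>
    ENNReal.mul_ne_top (ENNReal.rpow_ne_top_of_nonneg (hγ0 k k) hD1)
      (ENNReal.mul_ne_top (by simp) (ENNReal.prod_ne_top fun i _ =>
        ENNReal.mul_ne_top (hCtop k i) (ENNReal.rpow_ne_top_of_nonneg (hdiff k i) hD1)))
  refine ⟨D * ∑ k, K k, ENNReal.mul_ne_top hD1 (ENNReal.sum_ne_top.2 fun k _ => hK k), ?_⟩
  intro b c hc0 hc1 M hM
  let g : Fin (n + 1) → Fin (n + 1) → ℝ → ℝ≥0∞ := fun k i => (Set.Icc (-1 : ℝ) 1).indicator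
    fun t => if i = k then 1 else (min (D * c k) (c i / ‖t‖ₑ)) ^ γ k i
  have hg : ∀ k i, Measurable (g k i) := by
    intro k i
    refine Measurable.indicator ?_ measurableSet_Icc
    by_cases hik : i = k
    · simp [hik]
    · simp only [hik, if_false]
      fun_prop
  let H : Fin (n + 1) → EuclideanSpace ℝ (Fin (n + 1)) → ℝ≥0∞ := fun k x =>
    (D * c k) ^ γ k k * ∏ i, g k i (inner ℝ (b i) x)
  have hHm : ∀ k, Measurable (H k) := fun k =>
    (Finset.measurable_fun_prod _ fun i _ => (hg k i).comp (by fun_prop)).const_mul _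
  have hpt : ∀ x, x ≠ 0 → ‖x‖ < 1 → boxRadial b c (‖x‖⁻¹ • x) ^ α ≤ ∑ k, H k x := by
    intro x hx hx1
    obtain ⟨k, hk⟩ := exists_boxRadial_normalize_le b hx
    refine le_trans ?_ (Finset.single_le_sum (f := fun k => H k x) (fun _ _ => zero_le)
      (Finset.mem_univ k))
    rw [← hsum k, ENNReal.rpow_sum_of_nonneg _ fun i _ => hγ0 k i,
      ← Finset.mul_prod_erase _ _ (Finset.mem_univ k)]
    simp only [H]
    rw [← Finset.mul_prod_erase _ (fun i => g k i _) (Finset.mem_univ k)]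
    have hmem : ∀ i, inner ℝ (b i) x ∈ Set.Icc (-1 : ℝ) 1 := by
      intro i
      rw [Set.mem_Icc, ← abs_le]
      refine (abs_real_inner_le_norm _ _).trans ?_
      simpa using hx1.le
    have hgk : g k k (inner ℝ (b k) x) = 1 := by
      simp only [g]
      rw [Set.indicator_of_mem (hmem k)]
      simp
    rw [hgk, one_mul]
    refine mul_le_mul' (ENNReal.rpow_le_rpow (hk c) (hγ0 k k)) (Finset.prod_le_prod' ?_)
    intro i hi
    simp only [g]
    rw [Set.indicator_of_mem (hmem i), if_neg (Finset.ne_of_mem_erase hi)]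
    exact ENNReal.rpow_le_rpow (le_min (hk c) (boxRadial_normalize_le b c hx hx1 i)) (hγ0 k i)
  refine (lintegral_sphereMeasure_le ((measurable_boxRadial b c).pow_const α) hpt).trans ?_
  rw [lintegral_finsetSum _ fun k _ => hHm k, mul_assoc, Finset.sum_mul, ← hD]
  gcongr with k
  have hB0 : D * c k ≠ 0 := mul_ne_zero hD0 (hc0 k)
  have hB1 : D * c k ≠ ∞ := ENNReal.mul_ne_top hD1 (hc1 k)
  have hgint : ∀ i ∈ Finset.univ.erase k, ∫⁻ t, g k i t ≤
      (C k i * D ^ (γ k i - min (γ k i) 1)) *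
        (c i ^ min (γ k i) 1 * c k ^ (γ k i - min (γ k i) 1)) := by
    intro i hi
    have hik := Finset.ne_of_mem_erase hi
    simp only [g, hik, if_false]
    rw [lintegral_indicator measurableSet_Icc]
    refine (hC k i hik _ _ hB0 hB1 (hc0 i) (hc1 i)).trans (le_of_eq ?_)
    rw [ENNReal.mul_rpow_of_nonneg _ _ (hdiff k i)]
    ring
  have hgk : ∫⁻ t, g k k t = 2 := by
    simp only [g, if_true]
    rw [lintegral_indicator measurableSet_Icc]
    simp
    norm_num
  simp only [H]
  have hmeas : Measurable fun x => ∏ i, g k i (inner ℝ (b i) x) :=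
    Finset.measurable_fun_prod _ fun i _ => (hg k i).comp (by fun_prop)
  rw [lintegral_const_mul _ hmeas,
    lintegral_prod_inner b _ (hg k), ← Finset.mul_prod_erase _ _ (Finset.mem_univ k), hgk,
    ENNReal.mul_rpow_of_nonneg _ _ (hγ0 k k)]
  calc _ ≤ D ^ γ k k * c k ^ γ k k * (2 * ∏ i ∈ Finset.univ.erase k,
        ((C k i * D ^ (γ k i - min (γ k i) 1)) *
        (c i ^ min (γ k i) 1 * c k ^ (γ k i - min (γ k i) 1)))) := by
        gcongr with i hi
        exact hgint i hi
    _ = K k * (c k ^ γ k k * ∏ i ∈ Finset.univ.erase k,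
          (c i ^ min (γ k i) 1 * c k ^ (γ k i - min (γ k i) 1))) := by
        rw [Finset.prod_mul_distrib]
        simp only [K]
        ring
    _ ≤ K k * M := by
        gcongr
        exact hM k

theorem exists_lintegral_boxRadial_le_of_ge {n : ℕ} (hn : 1 ≤ n) {β : ℝ} (hβ : (n : ℝ) + 1 ≤ β) :
    ∃ K : ℝ≥0∞, K ≠ ∞ ∧
      ∀ (b : OrthonormalBasis (Fin (n + 1)) ℝ (EuclideanSpace ℝ (Fin (n + 1))))
        (c : Fin (n + 1) → ℝ≥0∞), (∀ i, c i ≠ 0) → (∀ i, c i ≠ ∞) →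
      ∀ m, (∀ i, c i ≤ c m) →
        ∫⁻ x : sphere (0 : EuclideanSpace ℝ (Fin (n + 1))) 1, boxRadial b c x ^ β
          ∂(sphereMeasure n) ≤ K * (c m ^ (β - n) * ∏ i ∈ Finset.univ.erase m, c i) := by
  have hn0 : (0 : ℝ) < n := by exact_mod_cast hn
  have hq : 1 < β / n := by rw [lt_div_iff₀ hn0]; linarith
  obtain ⟨K, hK, h⟩ := exists_lintegral_boxRadial_le (n := n) (α := β)
    (fun k i => if i = k then 0 else β / n)
    (fun k i => by split_ifs <;> linarith)
    (fun k i hik => by simp only [hik, if_false]; exact hq.ne')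
    (fun k => by
      rw [← Finset.add_sum_erase _ _ (Finset.mem_univ k), if_pos rfl,
        Finset.sum_congr rfl fun i hi => if_neg (Finset.ne_of_mem_erase hi)]
      simp [Finset.card_erase_of_mem]
      field_simp)
  refine ⟨K, hK, fun b c hc0 hc1 m hm => h b c hc0 hc1 _ fun k => ?_⟩
  have hprod : ∀ k, c k ^ (β - n) * ∏ i ∈ Finset.univ.erase k, c i
      = c k ^ (β - n - 1) * ∏ i, c i := by
    intro k
    rw [← Finset.mul_prod_erase _ _ (Finset.mem_univ k), ← mul_assoc]
    congr 1
    nth_rw 3 [← ENNReal.rpow_one (c k)]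
    rw [← ENNReal.rpow_add _ _ (hc0 k) (hc1 k), sub_add_cancel]
  calc _ = c k ^ (β - n) * ∏ i ∈ Finset.univ.erase k, c i := by
        rw [if_pos rfl, ENNReal.rpow_zero, one_mul,
          Finset.prod_congr rfl (g := fun i => c i * c k ^ (β / n - 1)) fun i hi => by
            rw [if_neg (Finset.ne_of_mem_erase hi), min_eq_right hq.le, ENNReal.rpow_one],
          Finset.prod_mul_distrib, Finset.prod_const, mul_comm, ← ENNReal.rpow_mul_natCast]
        congr 2
        simp [Finset.card_erase_of_mem]
        field_simp
    _ = c k ^ (β - n - 1) * ∏ i, c i := hprod k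
    _ ≤ c m ^ (β - n - 1) * ∏ i, c i := by
        gcongr
        · linarith
        · exact hm k
    _ = _ := (hprod m).symm

theorem exists_lintegral_boxRadial_le_of_lt {n : ℕ} (hn : 1 ≤ n) {α : ℝ} (h1 : 1 < α)
    (h2 : α < n + 1) (m : Fin (n + 1)) :
    ∃ K : ℝ≥0∞, K ≠ ∞ ∧
      ∀ (b : OrthonormalBasis (Fin (n + 1)) ℝ (EuclideanSpace ℝ (Fin (n + 1))))
        (c : Fin (n + 1) → ℝ≥0∞), (∀ i, c i ≠ 0) → (∀ i, c i ≠ ∞) →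
        ∫⁻ x : sphere (0 : EuclideanSpace ℝ (Fin (n + 1))) 1, boxRadial b c x ^ α
          ∂(sphereMeasure n) ≤ K * (c m * ∏ i ∈ Finset.univ.erase m, c i ^ ((α - 1) / n)) := by
  have hn0 : (0 : ℝ) < n := by exact_mod_cast hn
  set ρ := (α - 1) / n with hρ
  have hρ0 : 0 < ρ := div_pos (by linarith) hn0
  have hρ1 : ρ < 1 := by rw [hρ, div_lt_one hn0]; linarith
  have hρn : n * ρ = α - 1 := by rw [hρ]; field_simp
  obtain ⟨K, hK, h⟩ := exists_lintegral_boxRadial_le (n := n) (α := α)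
    (fun k i => if k = m then (if i = m then 1 else ρ) else
      (if i = k then 0 else if i = m then 1 + ρ else ρ))
    (fun k i => by split_ifs <;> linarith)
    (fun k i hik => by
      split_ifs with h1 h2 h3
      · exact absurd (h2.trans h1.symm) hik
      · exact hρ1.ne
      · linarith
      · exact hρ1.ne)
    (fun k => by
      by_cases hk : k = m
      · simp only [hk, if_true]
        rw [← Finset.add_sum_erase _ _ (Finset.mem_univ m), if_pos rfl,
          Finset.sum_congr rfl fun i hi => if_neg (Finset.ne_of_mem_erase hi)]
        simp [Finset.card_erase_of_mem, hρn]
      · have hmk : m ∈ Finset.univ.erase k := Finset.mem_erase.2 ⟨Ne.symm hk, Finset.mem_univ _⟩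
        simp only [hk, if_false]
        rw [← Finset.add_sum_erase _ _ (Finset.mem_univ k), if_pos rfl,
          ← Finset.add_sum_erase _ _ hmk, if_neg (Ne.symm hk), if_pos rfl,
          Finset.sum_congr rfl (g := fun _ => ρ) fun i hi => by
            rw [if_neg (Finset.ne_of_mem_erase (Finset.mem_of_mem_erase hi)),
              if_neg (Finset.ne_of_mem_erase hi)]]
        rw [Finset.sum_const, Finset.card_erase_of_mem hmk,
          Finset.card_erase_of_mem (Finset.mem_univ k), Finset.card_univ, Fintype.card_fin,
          nsmul_eq_mul, Nat.add_sub_cancel, Nat.cast_sub hn]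
        push_cast
        linarith)
  refine ⟨K, hK, fun b c hc0 hc1 => h b c hc0 hc1 _ fun k => le_of_eq ?_⟩
  by_cases hk : k = m
  · subst hk
    simp only [if_true, ENNReal.rpow_one]
    congr 1
    refine Finset.prod_congr rfl fun i hi => ?_
    rw [if_neg (Finset.ne_of_mem_erase hi), min_eq_left hρ1.le, sub_self, ENNReal.rpow_zero,
      mul_one]
  · have hmk : m ∈ Finset.univ.erase k := Finset.mem_erase.2 ⟨Ne.symm hk, Finset.mem_univ _⟩
    have hkm : k ∈ Finset.univ.erase m := Finset.mem_erase.2 ⟨hk, Finset.mem_univ _⟩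
    simp only [hk, if_false, if_true, ENNReal.rpow_zero, one_mul]
    rw [← Finset.mul_prod_erase _ _ hmk, if_neg (Ne.symm hk), if_pos rfl,
      ← Finset.mul_prod_erase _ _ hkm, min_eq_right (by linarith), ENNReal.rpow_one,
      add_sub_cancel_left, mul_assoc, Finset.erase_right_comm]
    congr 2
    refine Finset.prod_congr rfl fun i hi => ?_
    rw [if_neg (Finset.ne_of_mem_erase (Finset.mem_of_mem_erase (by
        rwa [Finset.erase_right_comm] at hi))), if_neg (Finset.ne_of_mem_erase
        (by rwa [Finset.erase_right_comm] at hi)), min_eq_left hρ1.le, sub_self,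
      ENNReal.rpow_zero, mul_one]

theorem exists_lintegral_boxRadial_le_of_le {n : ℕ} (hn : 1 ≤ n) {α : ℝ} (h1 : 1 < α)
    (h2 : α ≤ n + 1) (m : Fin (n + 1)) :
    ∃ K : ℝ≥0∞, K ≠ ∞ ∧
      ∀ (b : OrthonormalBasis (Fin (n + 1)) ℝ (EuclideanSpace ℝ (Fin (n + 1))))
        (c : Fin (n + 1) → ℝ≥0∞), (∀ i, c i ≠ 0) → (∀ i, c i ≠ ∞) →
        ∫⁻ x : sphere (0 : EuclideanSpace ℝ (Fin (n + 1))) 1, boxRadial b c x ^ α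
          ∂(sphereMeasure n) ≤ K * (c m * ∏ i ∈ Finset.univ.erase m, c i ^ ((α - 1) / n)) := by
  rcases h2.lt_or_eq with h2 | rfl
  · exact exists_lintegral_boxRadial_le_of_lt hn h1 h2 m
  · obtain ⟨K, hK, h⟩ := exists_lintegral_boxRadial_le_of_ge hn (le_refl ((n : ℝ) + 1))
    refine ⟨K, hK, fun b c hc0 hc1 => ?_⟩
    obtain ⟨k, hk⟩ := Finite.exists_max c
    refine (h b c hc0 hc1 k hk).trans (le_of_eq ?_)
    have hn0 : (n : ℝ) ≠ 0 := by positivity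
    rw [add_sub_cancel_left, add_sub_cancel_right, div_self hn0]
    simp only [ENNReal.rpow_one]
    rw [Finset.mul_prod_erase _ _ (Finset.mem_univ k),
      Finset.mul_prod_erase _ _ (Finset.mem_univ m)]

/-- The `L^p` norm over the sphere of the radial function of an orthotope. -/
noncomputable def boxRadialNorm {n : ℕ}
    (b : OrthonormalBasis (Fin (n + 1)) ℝ (EuclideanSpace ℝ (Fin (n + 1))))
    (c : Fin (n + 1) → ℝ≥0∞) (p : ℝ) : ℝ≥0∞ :=
  (∫⁻ x : sphere (0 : EuclideanSpace ℝ (Fin (n + 1))) 1, boxRadial b c x ^ p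
    ∂(sphereMeasure n)) ^ (1 / p)

instance {n : ℕ} : IsFiniteMeasure (sphereMeasure n) := by
  unfold sphereMeasure
  infer_instance

theorem boxRadialNorm_le_mul {n : ℕ} {p q : ℝ} (hp : 0 < p) (hpq : p ≤ q)
    (b : OrthonormalBasis (Fin (n + 1)) ℝ (EuclideanSpace ℝ (Fin (n + 1))))
    (c : Fin (n + 1) → ℝ≥0∞) :
    boxRadialNorm b c p ≤
      boxRadialNorm b c q * sphereMeasure n Set.univ ^ (1 / p - 1 / q) := by
  have := eLpNorm'_le_eLpNorm'_mul_rpow_measure_univ (μ := sphereMeasure n) hp hpq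
    (f := fun x => boxRadial b c x)
    ((measurable_boxRadial b c).comp measurable_subtype_coe).aestronglyMeasurable
  simpa [eLpNorm', boxRadialNorm] using this

theorem exists_boxRadialNorm_mul_le_of_eq {n : ℕ} (hn : 1 ≤ n) {u v : ℝ} (hv : 0 < v)
    (hvu : v ≤ u) (huv : u + n * v = 1) :
    ∃ K : ℝ≥0∞, K ≠ ∞ ∧
      ∀ (b : OrthonormalBasis (Fin (n + 1)) ℝ (EuclideanSpace ℝ (Fin (n + 1))))
        (a : Fin (n + 1) → ℝ≥0∞), (∀ i, a i ≠ 0) → (∀ i, a i ≠ ∞) →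
        boxRadialNorm b a (1 / u) * boxRadialNorm b (fun i => (a i)⁻¹) (1 / v) ≤ K := by
  have hn0 : (0 : ℝ) < n := by exact_mod_cast hn
  have hu : 0 < u := hv.trans_le hvu
  have hnv : 0 < n * v := by positivity
  choose K₁ hK₁ h₁ using fun m => exists_lintegral_boxRadial_le_of_le (n := n) (α := 1 / u) hn
    (by rw [lt_div_iff₀ hu]; linarith)
    (by rw [div_le_iff₀ hu]; nlinarith) m
  obtain ⟨K₂, hK₂, h₂⟩ := exists_lintegral_boxRadial_le_of_ge (n := n) (β := 1 / v) hn
    (by rw [le_div_iff₀ hv]; nlinarith)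
  refine ⟨(∑ m, K₁ m) ^ u * K₂ ^ v, ENNReal.mul_ne_top
    (ENNReal.rpow_ne_top_of_nonneg hu.le (ENNReal.sum_ne_top.2 fun m _ => hK₁ m))
    (ENNReal.rpow_ne_top_of_nonneg hv.le hK₂), fun b a ha0 ha1 => ?_⟩
  obtain ⟨m, hm⟩ := Finite.exists_min a
  have e₁ : boxRadialNorm b a (1 / u) ≤ (∑ m, K₁ m) ^ u *
      (a m ^ u * ∏ i ∈ Finset.univ.erase m, a i ^ v) := by
    unfold boxRadialNorm
    rw [one_div_one_div]
    refine (ENNReal.rpow_le_rpow (h₁ m b a ha0 ha1) hu.le).trans ?_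
    rw [ENNReal.mul_rpow_of_nonneg _ _ hu.le, ENNReal.mul_rpow_of_nonneg _ _ hu.le,
      ← ENNReal.prod_rpow_of_nonneg hu.le]
    refine mul_le_mul' (ENNReal.rpow_le_rpow (Finset.single_le_sum (f := K₁)
      (fun _ _ => zero_le) (Finset.mem_univ m)) hu.le) (mul_le_mul' le_rfl (le_of_eq ?_))
    refine Finset.prod_congr rfl fun i _ => ?_
    rw [← ENNReal.rpow_mul]
    congr 1
    field_simp
    linarith
  have e₂ : boxRadialNorm b (fun i => (a i)⁻¹) (1 / v) ≤ K₂ ^ v *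
      ((a m)⁻¹ ^ u * ∏ i ∈ Finset.univ.erase m, (a i)⁻¹ ^ v) := by
    unfold boxRadialNorm
    rw [one_div_one_div]
    refine (ENNReal.rpow_le_rpow (h₂ b (fun i => (a i)⁻¹) (by simpa using ha1) (by simpa using ha0)
      m fun i => ENNReal.inv_le_inv.2 (hm i)) hv.le).trans (le_of_eq ?_)
    rw [ENNReal.mul_rpow_of_nonneg _ _ hv.le, ENNReal.mul_rpow_of_nonneg _ _ hv.le,
      ← ENNReal.prod_rpow_of_nonneg hv.le, ← ENNReal.rpow_mul]
    congr 3
    field_simp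
    linarith
  have hinv : ∀ i (e : ℝ), a i ^ e * (a i)⁻¹ ^ e = 1 := fun i e => by
    rw [ENNReal.inv_rpow, ENNReal.mul_inv_cancel] <;> simp [ha0, ha1, ENNReal.rpow_eq_zero_iff,
      ENNReal.rpow_eq_top_iff]
  refine (mul_le_mul' e₁ e₂).trans (le_of_eq ?_)
  rw [mul_mul_mul_comm, mul_mul_mul_comm (a m ^ u), hinv, ← Finset.prod_mul_distrib,
    Finset.prod_congr rfl fun i _ => hinv i v]
  simp

theorem exists_boxRadialNorm_mul_le_of_le {n : ℕ} (hn : 1 ≤ n) {α β : ℝ} (hα : 0 < α)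
    (hαβ : α ≤ β) (h : 1 / α + (n : ℝ) / β ≥ 1) :
    ∃ K : ℝ≥0∞, K ≠ ∞ ∧
      ∀ (b : OrthonormalBasis (Fin (n + 1)) ℝ (EuclideanSpace ℝ (Fin (n + 1))))
        (a : Fin (n + 1) → ℝ≥0∞), (∀ i, a i ≠ 0) → (∀ i, a i ≠ ∞) →
        boxRadialNorm b a α * boxRadialNorm b (fun i => (a i)⁻¹) β ≤ K := by
  have hn0 : (0 : ℝ) < n := by exact_mod_cast hn
  have hβ : 0 < β := hα.trans_le hαβ
  have hvu : 1 / β ≤ 1 / α := one_div_le_one_div_of_le hα hαβ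
  set v := min (1 / β) (1 / ((n : ℝ) + 1)) with hv
  have hv0 : 0 < v := lt_min (by positivity) (by positivity)
  have hvβ : v ≤ 1 / β := min_le_left _ _
  have hvn : v * (n + 1) ≤ 1 := (le_div_iff₀ (by positivity)).1 (min_le_right _ _)
  have huα : 1 - n * v ≤ 1 / α := by
    rcases min_choice (1 / β) (1 / ((n : ℝ) + 1)) with h' | h'
    · rw [hv, h', mul_one_div]
      linarith
    · have h3 : 1 - n * v = v := by
        rw [hv, h']
        field_simp
        ring
      rw [h3]
      exact hvβ.trans hvu
  have hu0 : v ≤ 1 - n * v := by linarith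
  have hupos : 0 < 1 - n * v := hv0.trans_le hu0
  obtain ⟨K, hK, h⟩ := exists_boxRadialNorm_mul_le_of_eq hn hv0 hu0 (by ring)
  have hαu : α ≤ 1 / (1 - n * v) := (le_one_div hα hupos).2 huα
  have hβv : β ≤ 1 / v := (le_one_div hβ hv0).2 hvβ
  refine ⟨K * (sphereMeasure n Set.univ ^ (1 / α - 1 / (1 / (1 - n * v))) *
    sphereMeasure n Set.univ ^ (1 / β - 1 / (1 / v))), ENNReal.mul_ne_top hK
    (ENNReal.mul_ne_top (ENNReal.rpow_ne_top_of_nonneg ?_ (measure_ne_top _ _))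
      (ENNReal.rpow_ne_top_of_nonneg ?_ (measure_ne_top _ _))), fun b a ha0 ha1 => ?_⟩
  · rw [one_div_one_div]
    linarith
  · rw [one_div_one_div]
    linarith
  · refine (mul_le_mul' (boxRadialNorm_le_mul hα hαu b a)
      (boxRadialNorm_le_mul hβ hβv b _)).trans ?_
    rw [mul_mul_mul_comm]
    exact mul_le_mul' (h b a ha0 ha1) le_rfl

theorem exists_boxRadialNorm_mul_le {n : ℕ} (hn : 1 ≤ n) {α β : ℝ} (hα : 0 < α) (hβ : 0 < β)
    (h1 : (n : ℝ) / α + 1 / β ≥ 1) (h2 : 1 / α + (n : ℝ) / β ≥ 1) :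
    ∃ K : ℝ≥0∞, K ≠ ∞ ∧
      ∀ (b : OrthonormalBasis (Fin (n + 1)) ℝ (EuclideanSpace ℝ (Fin (n + 1))))
        (a : Fin (n + 1) → ℝ≥0∞), (∀ i, a i ≠ 0) → (∀ i, a i ≠ ∞) →
        boxRadialNorm b a α * boxRadialNorm b (fun i => (a i)⁻¹) β ≤ K := by
  rcases le_total α β with h | h
  · exact exists_boxRadialNorm_mul_le_of_le hn hα h h2
  · obtain ⟨K, hK, hab⟩ := exists_boxRadialNorm_mul_le_of_le hn hβ h (by linarith)
    refine ⟨K, hK, fun b a ha0 ha1 => ?_⟩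
    have := hab b (fun i => (a i)⁻¹) (by simpa using ha1) (by simpa using ha0)
    simpa only [inv_inv, mul_comm] using this

/-- A symmetric convex body contains an orthogonal frame which is comparable to it: the vectors are
chosen greedily, each as a longest vector of the body orthogonal to the previous ones. -/
theorem exists_orthonormal_comparable {E : Type*} [NormedAddCommGroup E] [InnerProductSpace ℝ E]
    [FiniteDimensional ℝ E] {K : Set E} (hK : IsCompact K) (hconv : Convex ℝ K)
    (h0 : (0 : E) ∈ interior K) (hneg : ∀ x ∈ K, -x ∈ K) (k : ℕ)
    (hk : k ≤ Module.finrank ℝ E) :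
    ∃ (v : Fin k → E) (a : Fin k → ℝ), Orthonormal ℝ v ∧ (∀ i, 0 < a i) ∧ (∀ i, a i • v i ∈ K) ∧
      (∀ x ∈ K, ∀ i, |inner ℝ (v i) x| ≤ 2 ^ k * a i) ∧
      ∀ x ∈ K, ((2 : ℝ) ^ k)⁻¹ • (x - ∑ i, inner ℝ (v i) x • v i) ∈ K := by
  induction k with
  | zero =>
    refine ⟨Fin.elim0, Fin.elim0, ⟨fun i => i.elim0, fun i => i.elim0⟩, fun i => i.elim0,
      fun i => i.elim0, fun _ _ i => i.elim0, fun x hx => by simpa using hx⟩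
  | succ k ih =>
    obtain ⟨v, a, hv, ha, haK, hle, hproj⟩ := ih (by omega)
    have hK0 : (0 : E) ∈ K := interior_subset h0
    have hclosed : IsClosed {y : E | ∀ i, inner ℝ (v i) y = 0} := by
      simp only [Set.ofPred_forall]
      exact isClosed_iInter fun i => isClosed_eq (by fun_prop) continuous_const
    obtain ⟨w, ⟨hwK, hwv⟩, hwmax⟩ := (hK.inter_right hclosed).exists_isMaxOn
      ⟨0, hK0, fun i => inner_zero_right _⟩ continuous_norm.continuousOn
    have hw0 : 0 < ‖w‖ := by
      have hlt : Module.finrank ℝ (Submodule.span ℝ (Set.range v)) < Module.finrank ℝ E :=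
        lt_of_le_of_lt (finrank_range_le_card v) (by simpa using hk)
      have hne : (Submodule.span ℝ (Set.range v))ᗮ ≠ ⊥ := by
        intro hbot
        rw [Submodule.orthogonal_eq_bot_iff] at hbot
        rw [hbot, finrank_top] at hlt
        exact lt_irrefl _ hlt
      obtain ⟨y, hy, hy0⟩ := Submodule.exists_mem_ne_zero_of_ne_bot hne
      obtain ⟨ε, hε, hball⟩ := Metric.mem_nhds_iff.1 (mem_interior_iff_mem_nhds.1 h0)
      have hy0' : 0 < ‖y‖ := norm_pos_iff.2 hy0
      have hs : 0 < ε / 2 / ‖y‖ := by positivity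
      have hmem : (ε / 2 / ‖y‖) • y ∈ K ∩ {y : E | ∀ i, inner ℝ (v i) y = 0} := by
        refine ⟨hball ?_, fun i => ?_⟩
        · rw [mem_ball_zero_iff, norm_smul, Real.norm_of_nonneg hs.le, div_mul_cancel₀ _ hy0'.ne']
          linarith
        · rw [inner_smul_right, (Submodule.mem_orthogonal _ y).1 hy _
            (Submodule.subset_span ⟨i, rfl⟩), mul_zero]
      refine lt_of_lt_of_le ?_ (hwmax hmem)
      exact norm_pos_iff.2 (smul_ne_zero hs.ne' hy0)
    set e : E := ‖w‖⁻¹ • w with he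
    have hwe : ‖w‖ • e = w := by rw [he, smul_smul, mul_inv_cancel₀ hw0.ne', one_smul]
    have he1 : ‖e‖ = 1 := by
      rw [he, norm_smul, norm_inv, norm_norm, inv_mul_cancel₀ hw0.ne']
    have hev : ∀ i, inner ℝ e (v i) = 0 := fun i => by
      rw [he, real_inner_smul_left, real_inner_comm, hwv i, mul_zero]
    have hsymm : ∀ t : ℝ, |t| ≤ ‖w‖ → t • e ∈ K := by
      intro t ht
      obtain ⟨ht1, ht2⟩ := abs_le.1 ht
      have := hconv hwK (hneg w hwK) (a := (1 + t / ‖w‖) / 2) (b := (1 - t / ‖w‖) / 2)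
        (by have : -1 ≤ t / ‖w‖ := by rw [le_div_iff₀ hw0]; linarith
            linarith)
        (by have : t / ‖w‖ ≤ 1 := by rw [div_le_iff₀ hw0]; linarith
            linarith) (by ring)
      convert this using 1
      rw [he, smul_neg, ← sub_eq_add_neg, ← sub_smul, smul_smul]
      congr 1
      field_simp
      ring
    have hsub : ∀ x, inner ℝ e (x - ∑ i, inner ℝ (v i) x • v i) = inner ℝ e x := fun x => by
      simp [inner_sub_right, inner_sum, inner_smul_right, hev]
    have hbound : ∀ x ∈ K, |(2 ^ k)⁻¹ * inner ℝ e x| ≤ ‖w‖ := by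
      intro x hx
      rw [← hsub x, ← inner_smul_right]
      refine (abs_real_inner_le_norm _ _).trans ?_
      rw [he1, one_mul]
      refine hwmax ⟨hproj x hx, fun i => ?_⟩
      rw [inner_smul_right, inner_sub_right, hv.inner_right_fintype, sub_self, mul_zero]
    refine ⟨Matrix.vecCons e v, Matrix.vecCons ‖w‖ a, orthonormal_vecCons_iff.2 ⟨he1, hev, hv⟩,
      ?_, ?_, ?_, ?_⟩
    · exact Fin.cases hw0 ha
    · refine Fin.cases ?_ haK
      simpa [hwe] using hwK
    · intro x hx
      refine Fin.cases ?_ fun i => ?_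
      · have := hbound x hx
        rw [abs_mul, abs_of_pos (by positivity), inv_mul_le_iff₀ (by positivity)] at this
        simp only [Matrix.cons_val_zero]
        refine this.trans (mul_le_mul_of_nonneg_right ?_ hw0.le)
        exact pow_le_pow_right₀ one_le_two (Nat.le_succ k)
      · simp only [Matrix.cons_val_succ]
        refine (hle x hx i).trans (mul_le_mul_of_nonneg_right ?_ (ha i).le)
        exact pow_le_pow_right₀ one_le_two (Nat.le_succ k)
    · intro x hx
      have := hconv (hproj x hx) (hneg _ (hsymm _ (hbound x hx))) (a := 1 / 2) (b := 1 / 2)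
        (by norm_num) (by norm_num) (by norm_num)
      convert this using 1
      rw [Fin.sum_univ_succ]
      simp only [Matrix.cons_val_zero, Matrix.cons_val_succ, pow_succ, mul_inv]
      module

theorem ofReal_radial_le_boxRadial {n : ℕ}
    (b : OrthonormalBasis (Fin (n + 1)) ℝ (EuclideanSpace ℝ (Fin (n + 1))))
    {Ω : Set (EuclideanSpace ℝ (Fin (n + 1)))} {c : Fin (n + 1) → ℝ} (hc : ∀ i, 0 < c i)
    (h : ∀ x ∈ Ω, ∀ i, |inner ℝ (b i) x| ≤ c i) (x : EuclideanSpace ℝ (Fin (n + 1))) :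
    ENNReal.ofReal (radial Ω x) ≤ boxRadial b (fun i => ENNReal.ofReal (c i)) x := by
  refine le_iInf fun i => ?_
  rcases eq_or_ne (inner ℝ (b i) x) 0 with h0 | h0
  · rw [h0, enorm_zero, ENNReal.div_zero (by simpa using hc i)]
    exact le_top
  · have hpos := abs_pos.2 h0
    rw [Real.enorm_eq_ofReal_abs, ← ENNReal.ofReal_div_of_pos hpos]
    refine ENNReal.ofReal_le_ofReal (Real.sSup_le ?_ (div_nonneg (hc i).le hpos.le))
    rintro l ⟨hl, hlx⟩
    rw [le_div_iff₀ hpos]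
    have := h _ hlx i
    rwa [inner_smul_right, abs_mul, abs_of_pos hl] at this

theorem ofReal_integral_radial_rpow_le {n : ℕ}
    (b : OrthonormalBasis (Fin (n + 1)) ℝ (EuclideanSpace ℝ (Fin (n + 1))))
    {Ω : Set (EuclideanSpace ℝ (Fin (n + 1)))} {c : Fin (n + 1) → ℝ} (hc : ∀ i, 0 < c i)
    (h : ∀ x ∈ Ω, ∀ i, |inner ℝ (b i) x| ≤ c i) {p : ℝ} (hp : 0 < p) :
    ENNReal.ofReal ((∫ x : sphere (0 : EuclideanSpace ℝ (Fin (n + 1))) 1,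
        radial Ω ↑x ^ p ∂(sphereMeasure n)) ^ (1 / p)) ≤
      boxRadialNorm b (fun i => ENNReal.ofReal (c i)) p := by
  have hr : ∀ x, 0 ≤ radial Ω x := fun x => Real.sSup_nonneg fun l hl => hl.1.le
  have hi : 0 ≤ ∫ x : sphere (0 : EuclideanSpace ℝ (Fin (n + 1))) 1,
      radial Ω ↑x ^ p ∂(sphereMeasure n) :=
    integral_nonneg fun x => Real.rpow_nonneg (hr _) _
  rw [← ENNReal.ofReal_rpow_of_nonneg hi (by positivity)]
  refine ENNReal.rpow_le_rpow ?_ (by positivity)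
  rw [← Real.enorm_of_nonneg hi]
  refine (enorm_integral_le_lintegral_enorm _).trans (lintegral_mono fun x => ?_)
  rw [Real.enorm_of_nonneg (Real.rpow_nonneg (hr _) _),
    ← ENNReal.ofReal_rpow_of_nonneg (hr _) hp.le]
  exact ENNReal.rpow_le_rpow (ofReal_radial_le_boxRadial b hc h x) hp.le

theorem boxRadialNorm_const_mul {n : ℕ}
    (b : OrthonormalBasis (Fin (n + 1)) ℝ (EuclideanSpace ℝ (Fin (n + 1))))
    (c : Fin (n + 1) → ℝ≥0∞) {p : ℝ} (hp : 0 < p) {s : ℝ≥0∞} (hs0 : s ≠ 0) (hs : s ≠ ∞) :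
    boxRadialNorm b (fun i => s * c i) p = s * boxRadialNorm b c p := by
  have h : ∀ x, boxRadial b (fun i => s * c i) x = s * boxRadial b c x := fun x => by
    simp only [boxRadial, mul_div_assoc, ENNReal.mul_iInf_of_ne hs0 hs]
  unfold boxRadialNorm
  simp_rw [h, ENNReal.mul_rpow_of_nonneg _ _ hp.le]
  rw [lintegral_const_mul' _ _ (ENNReal.rpow_ne_top_of_nonneg hp.le hs),
    ENNReal.mul_rpow_of_nonneg _ _ (by positivity), ← ENNReal.rpow_mul, mul_one_div_cancel hp.ne',
    ENNReal.rpow_one]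

/-- The generalised Blaschke–Santaló inequality for origin-symmetric convex bodies. -/
theorem generalized_blaschke_santalo_symmetric (n : ℕ) (hn : 1 ≤ n) (α β : ℝ)
    (hα : 0 < α) (hβ : 0 < β)
    (h1 : (n : ℝ) / α + 1 / β ≥ 1) (h2 : 1 / α + (n : ℝ) / β ≥ 1) :
    ∃ C : ℝ, ∀ Ω : Set (EuclideanSpace ℝ (Fin (n+1))),
      IsCompact Ω → Convex ℝ Ω → (0 : EuclideanSpace ℝ (Fin (n+1))) ∈ interior Ω →
      Ω = -Ω →
      (∫ x : sphere (0 : EuclideanSpace ℝ (Fin (n+1))) 1,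
          radial Ω ↑x ^ α ∂(sphereMeasure n)) ^ (1/α) *
      (∫ x : sphere (0 : EuclideanSpace ℝ (Fin (n+1))) 1,
          radial (polarBody Ω) ↑x ^ β ∂(sphereMeasure n)) ^ (1/β) ≤ C := by
  obtain ⟨K, hK, hKab⟩ := exists_boxRadialNorm_mul_le hn hα hβ h1 h2
  refine ⟨(2 ^ (n + 1) * K).toReal, fun Ω hΩ hconv h0 hsymm => ?_⟩
  have hneg : ∀ x ∈ Ω, -x ∈ Ω := fun x hx => by
    rw [hsymm]
    simpa using hx
  obtain ⟨v, a, hv, ha, haΩ, hle, -⟩ :=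
    exists_orthonormal_comparable hΩ hconv h0 hneg (n + 1) (by simp)
  let B := OrthonormalBasis.mk hv (by
    rw [hv.linearIndependent.span_eq_top_of_card_eq_finrank' (by simp)])
  have hB : ∀ i, B i = v i := fun i => by simp [B]
  have hpolar : ∀ y ∈ polarBody Ω, ∀ i, |inner ℝ (B i) y| ≤ (a i)⁻¹ := by
    intro y hy i
    have hin : ∀ x ∈ Ω, inner ℝ x y ≤ 1 := fun x hx => by
      have := hy x hx
      simpa [PiLp.inner_apply, mul_comm] using this
    have e₁ := hin _ (haΩ i)
    have e₂ := hin _ (hneg _ (haΩ i))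
    rw [inner_neg_left] at e₂
    rw [real_inner_smul_left] at e₁ e₂
    rw [hB, ← one_div, le_div_iff₀ (ha i), ← abs_of_pos (ha i), ← abs_mul, abs_le]
    constructor <;> linarith
  have hbody : ∀ x ∈ Ω, ∀ i, |inner ℝ (B i) x| ≤ 2 ^ (n + 1) * a i := fun x hx i => by
    rw [hB]
    exact hle x hx i
  have hr : ∀ (Ω : Set (EuclideanSpace ℝ (Fin (n + 1)))) (p : ℝ),
      0 ≤ (∫ x : sphere (0 : EuclideanSpace ℝ (Fin (n+1))) 1,
          radial Ω ↑x ^ p ∂(sphereMeasure n)) ^ (1 / p) := fun Ω p =>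
    Real.rpow_nonneg (integral_nonneg fun x =>
      Real.rpow_nonneg (Real.sSup_nonneg fun l hl => hl.1.le) _) _
  refine (ENNReal.ofReal_le_iff_le_toReal (ENNReal.mul_ne_top (by simp) hK)).1 ?_
  rw [ENNReal.ofReal_mul (hr _ _)]
  refine (mul_le_mul' (ofReal_integral_radial_rpow_le B (fun i => by have := ha i; positivity)
    hbody hα) (ofReal_integral_radial_rpow_le B (fun i => inv_pos.2 (ha i)) hpolar hβ)).trans ?_
  simp_rw [ENNReal.ofReal_inv_of_pos (ha _), ENNReal.ofReal_mul (pow_nonneg zero_le_two _),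
    ENNReal.ofReal_pow zero_le_two, ENNReal.ofReal_ofNat]
  rw [boxRadialNorm_const_mul B _ hα (by simp) (by simp), mul_assoc]
  gcongr
  exact hKab B _ (fun i => by simpa using ha i) fun i => ENNReal.ofReal_ne_top
end

section
/- (Sharpness) Let n ≥ 1 and α ≥ β > 0 with n/α + 1/β < 1. Then there is no finite constant C such that for every origin-symmetric convex body Ω in ℝ^{n+1}, (∫_{S^n} r_Ω^α dσ)^{1/α}·(∫_{S^n} r_{Ω^*}^β dσ)^{1/β} ≤ C. In fact, taking Ω = D(γ,1,...,1) the rhombus with vertices ±γe_1, ±e_2,...,±e_{n+1}, the product tends to +∞ as γ → +∞, growing like γ^{1−n/α−1/β}. -/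
open MeasureTheory Metric Filter

/-- The rhombus (cross-polytope) with vertices `±aᵢ eᵢ`. -/
noncomputable def rhombus (n : ℕ) (a : Fin (n+1) → ℝ) : Set (EuclideanSpace ℝ (Fin (n+1))) :=
  convexHull ℝ (⋃ i : Fin (n+1),
    {a i • EuclideanSpace.single i (1:ℝ), -(a i • EuclideanSpace.single i (1:ℝ))})

/-- The Blaschke–Santaló product of an origin-symmetric convex body. -/
noncomputable def BSproduct (n : ℕ) (α β : ℝ) (Ω : Set (EuclideanSpace ℝ (Fin (n+1)))) : ℝ :=
  (∫ x : sphere (0 : EuclideanSpace ℝ (Fin (n+1))) 1,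
      radial Ω ↑x ^ α ∂(sphereMeasure n)) ^ (1/α) *
  (∫ x : sphere (0 : EuclideanSpace ℝ (Fin (n+1))) 1,
      radial (polarBody Ω) ↑x ^ β ∂(sphereMeasure n)) ^ (1/β)

theorem radial_eq_inv {n : ℕ} {Ω : Set (EuclideanSpace ℝ (Fin (n+1)))}
    {x : EuclideanSpace ℝ (Fin (n+1))} {g : ℝ} (hg : 0 < g)
    (h : ∀ l : ℝ, 0 < l → (l • x ∈ Ω ↔ l * g ≤ 1)) : radial Ω x = g⁻¹ := by
  have hset : {l : ℝ | 0 < l ∧ l • x ∈ Ω} = Set.Ioc 0 g⁻¹ := by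
    ext l
    simp only [Set.mem_ofPred_eq, Set.mem_Ioc]
    refine and_congr_right fun hl => ?_
    rw [h l hl, le_inv_comm₀ hl hg, ← one_div, le_div_iff₀ hl, mul_comm]
  rw [radial, hset, csSup_Ioc (inv_pos.2 hg)]

/-- The gauge of the rhombus with vertices `±aᵢ eᵢ`. -/
noncomputable def rhombusGauge {n : ℕ} (a : Fin (n+1) → ℝ)
    (x : EuclideanSpace ℝ (Fin (n+1))) : ℝ :=
  ∑ i, |x i| / a i

/-- The gauge of the box `{y | ∀ i, |aᵢ yᵢ| ≤ 1}`. -/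
noncomputable def boxGauge {n : ℕ} (a : Fin (n+1) → ℝ)
    (y : EuclideanSpace ℝ (Fin (n+1))) : ℝ :=
  ‖fun i => a i * y i‖

theorem continuous_rhombusGauge {n : ℕ} (a : Fin (n+1) → ℝ) :
    Continuous (rhombusGauge a) := by
  unfold rhombusGauge
  fun_prop

theorem continuous_boxGauge {n : ℕ} (a : Fin (n+1) → ℝ) : Continuous (boxGauge a) := by
  unfold boxGauge
  fun_prop

theorem exists_coord_ne_zero {n : ℕ} {x : EuclideanSpace ℝ (Fin (n+1))} (hx : x ≠ 0) :
    ∃ i, x i ≠ 0 := by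
  contrapose! hx
  ext i
  simpa using hx i

theorem rhombusGauge_pos {n : ℕ} {a : Fin (n+1) → ℝ} (ha : ∀ i, 0 < a i)
    {x : EuclideanSpace ℝ (Fin (n+1))} (hx : x ≠ 0) : 0 < rhombusGauge a x := by
  obtain ⟨i, hi⟩ := exists_coord_ne_zero hx
  exact Finset.sum_pos' (fun j _ => div_nonneg (abs_nonneg _) (ha j).le)
    ⟨i, Finset.mem_univ i, div_pos (abs_pos.2 hi) (ha i)⟩

theorem boxGauge_pos {n : ℕ} {a : Fin (n+1) → ℝ} (ha : ∀ i, 0 < a i)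
    {x : EuclideanSpace ℝ (Fin (n+1))} (hx : x ≠ 0) : 0 < boxGauge a x := by
  obtain ⟨i, hi⟩ := exists_coord_ne_zero hx
  exact norm_pos_iff.2 fun h => mul_ne_zero (ha i).ne' hi (congrFun h i)

theorem rhombusGauge_smul {n : ℕ} (a : Fin (n+1) → ℝ) {l : ℝ} (hl : 0 < l)
    (x : EuclideanSpace ℝ (Fin (n+1))) : rhombusGauge a (l • x) = l * rhombusGauge a x := by
  simp [rhombusGauge, Finset.mul_sum, abs_mul, abs_of_pos hl, mul_div_assoc]

theorem boxGauge_smul {n : ℕ} (a : Fin (n+1) → ℝ) {l : ℝ} (hl : 0 < l)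
    (x : EuclideanSpace ℝ (Fin (n+1))) : boxGauge a (l • x) = l * boxGauge a x := by
  have : (fun i => a i * (l • x) i) = l • fun i => a i * x i := by
    ext i
    simp
    ring
  rw [boxGauge, this, norm_smul, Real.norm_of_nonneg hl.le, boxGauge]

theorem vertex_mem_rhombus {n : ℕ} (a : Fin (n+1) → ℝ) (i : Fin (n+1)) :
    a i • EuclideanSpace.single i (1:ℝ) ∈ rhombus n a :=
  subset_convexHull ℝ _ (Set.mem_iUnion.2 ⟨i, by simp⟩)

theorem neg_vertex_mem_rhombus {n : ℕ} (a : Fin (n+1) → ℝ) (i : Fin (n+1)) :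
    -(a i • EuclideanSpace.single i (1:ℝ)) ∈ rhombus n a :=
  subset_convexHull ℝ _ (Set.mem_iUnion.2 ⟨i, by simp⟩)

theorem convex_rhombus {n : ℕ} (a : Fin (n+1) → ℝ) : Convex ℝ (rhombus n a) :=
  convex_convexHull ℝ _

theorem zero_mem_rhombus {n : ℕ} (a : Fin (n+1) → ℝ) :
    (0 : EuclideanSpace ℝ (Fin (n+1))) ∈ rhombus n a := by
  simpa using (convex_rhombus a).midpoint_mem (vertex_mem_rhombus a 0) (neg_vertex_mem_rhombus a 0)

theorem convex_rhombusGauge_le {n : ℕ} {a : Fin (n+1) → ℝ} (ha : ∀ i, 0 < a i) :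
    Convex ℝ {x | rhombusGauge a x ≤ 1} := by
  intro x hx y hy s t hs ht hst
  simp only [Set.mem_ofPred_eq] at *
  calc rhombusGauge a (s • x + t • y)
      ≤ ∑ i, (s * (|x i| / a i) + t * (|y i| / a i)) := by
        refine Finset.sum_le_sum fun i _ => ?_
        rw [← mul_div_assoc, ← mul_div_assoc, ← add_div]
        refine div_le_div_of_nonneg_right ?_ (ha i).le
        refine (abs_add_le _ _).trans_eq ?_
        simp [abs_mul, abs_of_nonneg hs, abs_of_nonneg ht]
    _ = s * rhombusGauge a x + t * rhombusGauge a y := by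
        rw [Finset.sum_add_distrib, ← Finset.mul_sum, ← Finset.mul_sum, rhombusGauge,
          rhombusGauge]
    _ ≤ s * 1 + t * 1 := by gcongr
    _ = 1 := by linarith

theorem mem_rhombus_iff {n : ℕ} {a : Fin (n+1) → ℝ} (ha : ∀ i, 0 < a i)
    (x : EuclideanSpace ℝ (Fin (n+1))) : x ∈ rhombus n a ↔ rhombusGauge a x ≤ 1 := by
  constructor
  · intro hx
    refine convexHull_min ?_ (convex_rhombusGauge_le ha) hx
    refine Set.iUnion_subset fun i => ?_
    have key : rhombusGauge a (a i • EuclideanSpace.single i (1:ℝ)) = 1 := by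
      rw [rhombusGauge, Finset.sum_eq_single i]
      · simp [abs_of_pos (ha i), (ha i).ne']
      · intro j _ hj
        simp [hj]
      · simp
    have key' : rhombusGauge a (-(a i • EuclideanSpace.single i (1:ℝ))) = 1 := by
      refine Eq.trans ?_ key
      simp only [rhombusGauge, PiLp.neg_apply, abs_neg]
    rintro y (rfl | rfl)
    · exact key.le
    · exact key'.le
  · intro hx
    let w : Option (Fin (n+1)) → ℝ :=
      fun o => o.elim (1 - rhombusGauge a x) fun i => |x i| / a i
    let z : Option (Fin (n+1)) → EuclideanSpace ℝ (Fin (n+1)) :=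
      fun o => o.elim 0 fun i => if 0 ≤ x i then a i • EuclideanSpace.single i (1:ℝ)
        else -(a i • EuclideanSpace.single i (1:ℝ))
    have hmem : ∑ o, w o • z o ∈ rhombus n a := by
      refine (convex_rhombus a).sum_mem ?_ ?_ ?_
      · rintro (_ | i) _
        · exact sub_nonneg.2 hx
        · exact div_nonneg (abs_nonneg _) (ha i).le
      · rw [Fintype.sum_option]
        simp [w, rhombusGauge]
      · rintro (_ | i) _
        · exact zero_mem_rhombus a
        · by_cases h : 0 ≤ x i
          · simpa [z, h] using vertex_mem_rhombus a i
          · simpa [z, h] using neg_vertex_mem_rhombus a i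
    have hterm : ∀ i, w (some i) • z (some i) = x i • EuclideanSpace.single i (1:ℝ) := by
      intro i
      have hai := (ha i).ne'
      by_cases h : 0 ≤ x i
      · simp [w, z, h, abs_of_nonneg h, smul_smul, hai]
      · simp only [w, z, Option.elim, h, if_false, abs_of_neg (not_le.1 h), smul_neg, smul_smul]
        rw [← neg_smul]
        congr 1
        field_simp
    have hsum : ∑ o, w o • z o = x := by
      rw [Fintype.sum_option, Finset.sum_congr rfl fun i _ => hterm i]
      ext j
      simp [z, Pi.single_apply]
    rwa [hsum] at hmem

theorem mem_polarBody_rhombus_iff {n : ℕ} {a : Fin (n+1) → ℝ} (ha : ∀ i, 0 < a i)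
    (y : EuclideanSpace ℝ (Fin (n+1))) :
    y ∈ polarBody (rhombus n a) ↔ boxGauge a y ≤ 1 := by
  rw [boxGauge, pi_norm_le_iff_of_nonneg zero_le_one]
  simp only [Real.norm_eq_abs]
  constructor
  · intro hy i
    have h1 := hy _ (vertex_mem_rhombus a i)
    have h2 := hy _ (neg_vertex_mem_rhombus a i)
    simp at h1 h2
    exact abs_le.2 ⟨by linarith, h1⟩
  · intro hy x hx
    refine le_trans (Finset.sum_le_sum fun i _ => ?_) ((mem_rhombus_iff ha x).1 hx)
    have hi := (ha i).ne'
    calc x i * y i ≤ |x i * y i| := le_abs_self _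
      _ = |x i| / a i * |a i * y i| := by
        rw [abs_mul, abs_mul, abs_of_pos (ha i)]
        field_simp
      _ ≤ |x i| / a i * 1 :=
        mul_le_mul_of_nonneg_left (hy i) (div_nonneg (abs_nonneg _) (ha i).le)
      _ = |x i| / a i := mul_one _

theorem radial_rhombus {n : ℕ} {a : Fin (n+1) → ℝ} (ha : ∀ i, 0 < a i)
    {x : EuclideanSpace ℝ (Fin (n+1))} (hx : x ≠ 0) :
    radial (rhombus n a) x = (rhombusGauge a x)⁻¹ :=
  radial_eq_inv (rhombusGauge_pos ha hx) fun l hl => by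
    rw [mem_rhombus_iff ha, rhombusGauge_smul a hl]

theorem radial_polarBody_rhombus {n : ℕ} {a : Fin (n+1) → ℝ} (ha : ∀ i, 0 < a i)
    {x : EuclideanSpace ℝ (Fin (n+1))} (hx : x ≠ 0) :
    radial (polarBody (rhombus n a)) x = (boxGauge a x)⁻¹ :=
  radial_eq_inv (boxGauge_pos ha hx) fun l hl => by
    rw [mem_polarBody_rhombus_iff ha, boxGauge_smul a hl]

theorem isCompact_rhombus {n : ℕ} (a : Fin (n+1) → ℝ) : IsCompact (rhombus n a) :=
  Set.Finite.isCompact_convexHull ℝ (Set.finite_iUnion fun _ => Set.toFinite _)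

theorem zero_mem_interior_rhombus {n : ℕ} {a : Fin (n+1) → ℝ} (ha : ∀ i, 0 < a i) :
    (0 : EuclideanSpace ℝ (Fin (n+1))) ∈ interior (rhombus n a) := by
  refine mem_interior.2 ⟨{x | rhombusGauge a x < 1}, fun x hx => ?_,
    isOpen_lt (continuous_rhombusGauge a) continuous_const, ?_⟩
  · exact (mem_rhombus_iff ha x).2 (le_of_lt hx)
  · simp [rhombusGauge]

theorem rhombus_eq_neg {n : ℕ} {a : Fin (n+1) → ℝ} (ha : ∀ i, 0 < a i) :
    rhombus n a = -rhombus n a := by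
  ext x
  rw [Set.mem_neg, mem_rhombus_iff ha, mem_rhombus_iff ha]
  simp [rhombusGauge]

/-- The part of the sphere where the coordinates indexed by `T` are at most `1 / γ` in absolute
value. -/
def sphereBand {n : ℕ} (T : Finset (Fin (n+1))) (γ : ℝ) :
    Set (sphere (0 : EuclideanSpace ℝ (Fin (n+1))) 1) :=
  {x | ∀ i ∈ T, |(x : EuclideanSpace ℝ (Fin (n+1))) i| ≤ 1 / γ}

theorem measurableSet_sphereBand {n : ℕ} (T : Finset (Fin (n+1))) (γ : ℝ) :
    MeasurableSet (sphereBand T γ) := by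
  refine IsClosed.measurableSet ?_
  simp only [sphereBand, Set.ofPred_forall]
  refine isClosed_iInter fun i => isClosed_iInter fun _ => isClosed_le ?_ continuous_const
  fun_prop

theorem volume_pi_Icc_euclidean {n : ℕ} (u v : Fin (n+1) → ℝ) :
    volume {y : EuclideanSpace ℝ (Fin (n+1)) | ∀ i, u i ≤ y i ∧ y i ≤ v i} =
      ∏ i, ENNReal.ofReal (v i - u i) := by
  rw [← Real.volume_Icc_pi,
    ← (PiLp.volume_preserving_ofLp (Fin (n+1))).measure_preimage
      measurableSet_Icc.nullMeasurableSet]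
  congr 1
  ext y
  simp [Pi.le_def, forall_and]

open scoped Pointwise in
/-- The cone over `sphereBand T γ` contains a box whose edges in the directions of `T` have
length comparable to `1 / γ` and whose other edges have length comparable to `1`. -/
theorem box_subset_cone_sphereBand {n : ℕ} {T : Finset (Fin (n+1))} {k : Fin (n+1)} (hk : k ∉ T)
    {γ c : ℝ} (hγ : 1 ≤ γ) (hc : 0 < c) (hcn : (n + 1) * (2 * c) ^ 2 < 1) :
    {y : EuclideanSpace ℝ (Fin (n+1)) | ∀ i, (if i ∈ T then 0 else c) ≤ y i ∧
      y i ≤ (if i ∈ T then c / γ else 2 * c)} ⊆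
      Set.Ioo (0:ℝ) 1 • (Subtype.val '' sphereBand T γ) := by
  intro y hy
  have hγ0 : 0 < γ := by linarith
  have hcy : c ≤ ‖y‖ := by
    have h1 := (hy k).1
    rw [if_neg hk] at h1
    exact h1.trans ((le_abs_self _).trans (PiLp.norm_apply_le y k))
  have hy0 : 0 < ‖y‖ := hc.trans_le hcy
  have hy1 : ‖y‖ < 1 := by
    have h2 : ‖y‖ ^ 2 ≤ (n + 1) * (2 * c) ^ 2 := by
      rw [EuclideanSpace.real_norm_sq_eq]
      calc ∑ i, y i ^ 2 ≤ ∑ _i : Fin (n+1), (2 * c) ^ 2 := by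
            refine Finset.sum_le_sum fun i _ => ?_
            have hi := hy i
            have hcγ : c / γ ≤ c := div_le_self hc.le hγ
            split_ifs at hi
            · exact pow_le_pow_left₀ hi.1 (by linarith [hi.2]) 2
            · exact pow_le_pow_left₀ (by linarith [hi.1]) hi.2 2
        _ = (n + 1) * (2 * c) ^ 2 := by simp
    nlinarith
  have hns : ‖y‖⁻¹ • y ∈ sphere (0 : EuclideanSpace ℝ (Fin (n+1))) 1 := by
    simp [norm_smul, hy0.ne']
  refine Set.mem_smul.2 ⟨‖y‖, ⟨hy0, hy1⟩, ‖y‖⁻¹ • y, ⟨⟨_, hns⟩, fun i hi => ?_, rfl⟩, ?_⟩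
  · have hyi := hy i
    rw [if_pos hi, if_pos hi] at hyi
    have : |(‖y‖⁻¹ • y) i| = y i / ‖y‖ := by
      simp [abs_mul, abs_of_nonneg hyi.1, div_eq_inv_mul]
    rw [this, div_le_iff₀ hy0]
    calc y i ≤ c / γ := hyi.2
      _ ≤ ‖y‖ / γ := by gcongr
      _ = 1 / γ * ‖y‖ := by ring
  · rw [smul_smul, mul_inv_cancel₀ hy0.ne', one_smul]

instance isFiniteMeasure_sphereMeasure (n : ℕ) : IsFiniteMeasure (sphereMeasure n) := by
  unfold sphereMeasure
  infer_instance

open scoped Pointwise in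
theorem exists_le_measure_sphereBand (n : ℕ) : ∃ K : ℝ, 0 < K ∧
    ∀ (T : Finset (Fin (n+1))) (k : Fin (n+1)), k ∉ T → ∀ γ : ℝ, 1 ≤ γ →
      K * γ⁻¹ ^ T.card ≤ (sphereMeasure n).real (sphereBand T γ) := by
  obtain ⟨c, hc, hcn⟩ : ∃ c : ℝ, 0 < c ∧ (n + 1) * (2 * c) ^ 2 < 1 := by
    refine ⟨1 / (4 * (n + 1)), by positivity, ?_⟩
    have hn : (0:ℝ) < n + 1 := by positivity
    field_simp
    nlinarith
  refine ⟨c ^ (n+1), by positivity, fun T k hk γ hγ => ?_⟩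
  have hγ0 : 0 < γ := by linarith
  refine (ENNReal.ofReal_le_iff_le_toReal (measure_ne_top _ _)).1 ?_
  rw [sphereMeasure, Measure.toSphere_apply' _ (measurableSet_sphereBand T γ)]
  calc ENNReal.ofReal (c ^ (n+1) * γ⁻¹ ^ T.card)
      = volume {y : EuclideanSpace ℝ (Fin (n+1)) | ∀ i, (if i ∈ T then 0 else c) ≤ y i ∧
          y i ≤ (if i ∈ T then c / γ else 2 * c)} := by
        rw [volume_pi_Icc_euclidean, ← ENNReal.ofReal_prod_of_nonneg]
        · congr 1
          have hprod : ∀ i, (if i ∈ T then c / γ else 2 * c) - (if i ∈ T then 0 else c) =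
              c * (if i ∈ T then γ⁻¹ else 1) := by
            intro i
            split_ifs <;> ring
          simp_rw [hprod, Finset.prod_mul_distrib, Finset.prod_ite_mem]
          simp
        · intro i _
          split_ifs
          · simpa using (div_pos hc hγ0).le
          · linarith
    _ ≤ volume (Set.Ioo (0:ℝ) 1 • (Subtype.val '' sphereBand T γ)) :=
        measure_mono (box_subset_cone_sphereBand hk hγ hc hcn)
    _ ≤ _ := le_mul_of_one_le_left zero_le (by simp)

theorem rpow_mul_measure_le_integral_radial {n : ℕ} {Ω : Set (EuclideanSpace ℝ (Fin (n+1)))}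
    {g : EuclideanSpace ℝ (Fin (n+1)) → ℝ} (hg : Continuous g) (hpos : ∀ x, x ≠ 0 → 0 < g x)
    (hr : ∀ x, x ≠ 0 → radial Ω x = (g x)⁻¹) {p R : ℝ} (hp : 0 < p) (hR : 0 < R)
    {s : Set (sphere (0 : EuclideanSpace ℝ (Fin (n+1))) 1)} (hs : ∀ x ∈ s, g x ≤ R⁻¹) :
    R ^ p * (sphereMeasure n).real s ≤
      ∫ x : sphere (0 : EuclideanSpace ℝ (Fin (n+1))) 1, radial Ω ↑x ^ p ∂(sphereMeasure n) := by
  have hx0 : ∀ x : sphere (0 : EuclideanSpace ℝ (Fin (n+1))) 1,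
      (x : EuclideanSpace ℝ (Fin (n+1))) ≠ 0 := fun x => ne_zero_of_mem_unit_sphere x
  simp_rw [fun x : sphere (0 : EuclideanSpace ℝ (Fin (n+1))) 1 => hr x (hx0 x)]
  have hcont : Continuous fun x : sphere (0 : EuclideanSpace ℝ (Fin (n+1))) 1 =>
      (g ↑x)⁻¹ ^ p :=
    ((hg.comp continuous_subtype_val).inv₀ fun x : sphere _ _ =>
      (hpos x (hx0 x)).ne').rpow_const fun _ => Or.inr hp.le
  refine le_trans ?_ (mul_meas_ge_le_integral_of_nonneg
    (.of_forall fun x : sphere (0 : EuclideanSpace ℝ (Fin (n+1))) 1 =>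
      Real.rpow_nonneg (inv_nonneg.2 (hpos x (hx0 x)).le) p)
    (hcont.integrable_of_hasCompactSupport (.of_compactSpace _)) (R ^ p))
  refine mul_le_mul_of_nonneg_left (measureReal_mono fun x hx => ?_) (by positivity)
  exact Real.rpow_le_rpow hR.le ((le_inv_comm₀ hR (hpos x (hx0 x))).2 (hs x hx)) hp.le

theorem abs_coord_le_one {n : ℕ} (x : sphere (0 : EuclideanSpace ℝ (Fin (n+1))) 1)
    (i : Fin (n+1)) : |(x : EuclideanSpace ℝ (Fin (n+1))) i| ≤ 1 := by
  simpa using PiLp.norm_apply_le (x : EuclideanSpace ℝ (Fin (n+1))) i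

theorem rhombusGauge_le_of_mem_sphereBand {n : ℕ} {γ : ℝ} (hγ : 1 ≤ γ)
    {x : sphere (0 : EuclideanSpace ℝ (Fin (n+1))) 1}
    (hx : x ∈ sphereBand (Finset.univ.erase 0) γ) :
    rhombusGauge (fun i => if i = 0 then γ else 1) (x : EuclideanSpace ℝ (Fin (n+1))) ≤
      (γ / (n + 1))⁻¹ := by
  calc rhombusGauge (fun i => if i = 0 then γ else 1) (x : EuclideanSpace ℝ (Fin (n+1)))
      ≤ ∑ _i : Fin (n+1), 1 / γ := by
        refine Finset.sum_le_sum fun i _ => ?_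
        by_cases hi : i = 0
        · simp only [if_pos hi]
          exact div_le_div_of_nonneg_right (abs_coord_le_one x i) (by linarith)
        · simpa [hi] using hx i (by simp [hi])
    _ = (γ / (n + 1))⁻¹ := by
        simp
        ring

theorem boxGauge_le_of_mem_sphereBand {n : ℕ} {γ : ℝ} (hγ : 1 ≤ γ)
    {x : sphere (0 : EuclideanSpace ℝ (Fin (n+1))) 1} (hx : x ∈ sphereBand {0} γ) :
    boxGauge (fun i => if i = 0 then γ else 1) (x : EuclideanSpace ℝ (Fin (n+1))) ≤ 1⁻¹ := by
  have hγ0 : 0 < γ := by linarith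
  rw [inv_one, boxGauge, pi_norm_le_iff_of_nonneg zero_le_one]
  intro i
  by_cases hi : i = 0
  · have h1 := hx i (by simp [hi])
    rw [le_div_iff₀ hγ0] at h1
    simpa [hi, abs_mul, abs_of_pos hγ0, mul_comm] using h1
  · simpa [hi] using abs_coord_le_one x i

theorem exists_le_BSproduct_rhombus {n : ℕ} (hn : 1 ≤ n) {α β : ℝ} (hα : 0 < α) (hβ : 0 < β) :
    ∃ K : ℝ, 0 < K ∧ ∀ γ : ℝ, 1 ≤ γ →
      K * γ ^ (1 - n / α - 1 / β) ≤
        BSproduct n α β (rhombus n (fun i => if i = 0 then γ else 1)) := by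
  obtain ⟨K, hK, hband⟩ := exists_le_measure_sphereBand n
  have hn1 : (0:ℝ) < n + 1 := by positivity
  refine ⟨(n + 1 : ℝ)⁻¹ * K ^ (1 / α) * K ^ (1 / β), by positivity, fun γ hγ => ?_⟩
  have hγ0 : 0 < γ := by linarith
  have ha : ∀ i : Fin (n+1), 0 < (if i = 0 then γ else 1) := fun i => by
    split_ifs <;> linarith
  have hcap := hband (Finset.univ.erase 0) 0 (by simp) γ hγ
  have hbelt := hband {0} (Fin.last n) (by simp [Fin.ext_iff]; omega) γ hγ
  rw [Finset.card_erase_of_mem (Finset.mem_univ _), Finset.card_univ, Fintype.card_fin,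
    Nat.add_sub_cancel] at hcap
  rw [Finset.card_singleton, pow_one] at hbelt
  have h1 := rpow_mul_measure_le_integral_radial (continuous_rhombusGauge _)
    (fun _ => rhombusGauge_pos ha) (fun _ => radial_rhombus ha) hα (div_pos hγ0 hn1)
    fun _ hx => rhombusGauge_le_of_mem_sphereBand hγ hx
  have h2 := rpow_mul_measure_le_integral_radial (continuous_boxGauge _)
    (fun _ => boxGauge_pos ha) (fun _ => radial_polarBody_rhombus ha) hβ one_pos
    fun _ hx => boxGauge_le_of_mem_sphereBand hγ hx
  rw [Real.one_rpow, one_mul] at h2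
  have h1' := (mul_le_mul_of_nonneg_left hcap (by positivity)).trans h1
  have h2' := hbelt.trans h2
  refine le_trans (le_of_eq ?_) (mul_le_mul
    (Real.rpow_le_rpow (by positivity) h1' (by positivity : 0 ≤ 1 / α))
    (Real.rpow_le_rpow (by positivity) h2' (by positivity : 0 ≤ 1 / β)) (by positivity)
    (Real.rpow_nonneg ((by positivity : (0:ℝ) ≤ _).trans h1') _))
  rw [Real.mul_rpow (by positivity) (by positivity), Real.mul_rpow (by positivity) (by positivity),
    Real.mul_rpow (by positivity) (by positivity), ← Real.rpow_mul (by positivity),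
    mul_one_div_cancel hα.ne', Real.rpow_one, ← Real.rpow_natCast γ⁻¹ n,
    ← Real.rpow_mul (by positivity), Real.inv_rpow hγ0.le, Real.inv_rpow hγ0.le,
    Real.rpow_sub hγ0, Real.rpow_sub hγ0, Real.rpow_one, mul_one_div]
  field_simp

/-- Sharpness of the condition in the generalised Blaschke–Santaló inequality: if
`n/α + 1/β < 1` (with `α ≥ β > 0`), then no finite constant bounds the product over all
origin-symmetric convex bodies; indeed, for the rhombus `D(γ,1,…,1)` the product tends
to `+∞` as `γ → +∞`. -/
theorem blaschke_santalo_sharpness (n : ℕ) (hn : 1 ≤ n) (α β : ℝ)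
    (hβ : 0 < β) (hβα : β ≤ α) (h : (n : ℝ) / α + 1 / β < 1) :
    (¬ ∃ C : ℝ, ∀ Ω : Set (EuclideanSpace ℝ (Fin (n+1))),
        IsCompact Ω → Convex ℝ Ω → (0 : EuclideanSpace ℝ (Fin (n+1))) ∈ interior Ω →
        Ω = -Ω → BSproduct n α β Ω ≤ C) ∧
    Tendsto (fun γ : ℝ =>
        BSproduct n α β (rhombus n (fun i => if i = 0 then γ else 1)))
      atTop atTop := by
  have hα : 0 < α := hβ.trans_le hβα
  obtain ⟨K, hK, hle⟩ := exists_le_BSproduct_rhombus hn hα hβ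
  have htop : Tendsto (fun γ : ℝ =>
      BSproduct n α β (rhombus n (fun i => if i = 0 then γ else 1))) atTop atTop :=
    tendsto_atTop_mono' atTop ((eventually_ge_atTop 1).mono hle)
      ((tendsto_rpow_atTop (by linarith)).const_mul_atTop hK)
  refine ⟨?_, htop⟩
  rintro ⟨C, hC⟩
  obtain ⟨γ, hγC, hγ⟩ := ((htop.eventually_gt_atTop C).and (eventually_gt_atTop 0)).exists
  have ha : ∀ i : Fin (n+1), 0 < (if i = 0 then γ else 1) := fun i => by
    split_ifs <;> linarith
  exact hγC.not_ge (hC _ (isCompact_rhombus _) (convex_rhombus _)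
    (zero_mem_interior_rhombus ha) (rhombus_eq_neg ha))
end
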